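/- Suppose n ≥ 3, A is an arm sequence, λ is an A-regular partition, and i ∈ ℤ/nℤ. Then: (1) if f̃_i λ ≠ 0, then f̃_i λ is A-regular; (2) if ẽ_i λ ≠ 0, then ẽ_i λ is A-regular. -/

import Mathlib

/-!  Partitions, arm sequences and the crystal operators `ẽ_i`, `f̃_i` of the paper
"Partition models for the crystal of the basic `U_q(ŝl_n)`-module".

A partition is modelled as a function `l : ℕ → ℕ` listing the parts, with rows indexed
from `0`; the Young diagram consists of the nodes `(a, c)` (row `a`, column `c`, both
`0`-indexed) with `c < l a`.  The node `(a, c)` here corresponds to the node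
`(a + 1, c + 1)` in the (1-indexed) conventions of the paper; in particular its residue
is `c - a (mod n)`, its arm length is `l a - c - 1`, and its hook length is
`l a - c + l' c - a - 1`, where `l'` is the conjugate partition. -/

attribute [local instance] Classical.propDecidable

namespace ArmCrystal

/-- `l` is a partition: weakly decreasing with some part equal to `0`. -/
def IsPartition (l : ℕ → ℕ) : Prop := (∀ a, l (a + 1) ≤ l a) ∧ ∃ N, l N = 0

/-- The conjugate partition: `conj l c` is the number of rows `a` with `l a > c`,
i.e. the number of nodes in column `c`. -/
noncomputable def conj (l : ℕ → ℕ) (c : ℕ) : ℕ := sInf {a | l a ≤ c}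

/-- `A` is an arm sequence for `n`: `t - 1 ≤ A t ≤ (n-1)t` for `t ≥ 1`, and
`A (t + u) ∈ {A t + A u, A t + A u + 1}`.  (The value `A 0` is irrelevant; in the
definition of the order on nodes it is read as `0`, via `Aext`.) -/
def IsArmSeq (n : ℕ) (A : ℕ → ℤ) : Prop :=
  (∀ t : ℕ, 1 ≤ t → (t : ℤ) - 1 ≤ A t ∧ A t ≤ ((n : ℤ) - 1) * t) ∧
  (∀ t u : ℕ, 1 ≤ t → 1 ≤ u → A (t + u) = A t + A u ∨ A (t + u) = A t + A u + 1)

/-- `A` extended by `A 0 = 0`. -/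
def Aext (A : ℕ → ℤ) (t : ℕ) : ℤ := if t = 0 then 0 else A t

/-- The `(a, c)`-hook of `l` is illegal with parameter `t ≥ 1`: `(a, c)` is a node of
`l` whose hook length is `n * t` and whose arm length is `A t`. -/
def IllegalHook (n : ℕ) (A : ℕ → ℤ) (l : ℕ → ℕ) (a c t : ℕ) : Prop :=
  1 ≤ t ∧ c < l a ∧
  ((l a : ℤ) + conj l c = (n : ℤ) * t + a + c + 1) ∧
  ((l a : ℤ) = A t + c + 1)

/-- `l` is `A`-regular: it has no illegal hook. -/
def ARegular (n : ℕ) (A : ℕ → ℤ) (l : ℕ → ℕ) : Prop :=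
  ¬ ∃ a c t, IllegalHook n A l a c t

/-- `(a, c)` is a removable node of `l`. -/
def Removable (l : ℕ → ℕ) (a c : ℕ) : Prop := l a = c + 1 ∧ l (a + 1) ≤ c

/-- `(a, c)` is an addable node of `l`. -/
def Addable (l : ℕ → ℕ) (a c : ℕ) : Prop := l a = c ∧ (a = 0 ∨ c < l (a - 1))

/-- The residue of the node `(a, c)` (0-indexed), namely `c - a ∈ ℤ/nℤ`. -/
def res (n : ℕ) (x : ℕ × ℕ) : ZMod n := (x.2 : ZMod n) - (x.1 : ZMod n)

/-- The total order `≻` determined by the arm sequence `A` on the nodes of a fixed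
residue: for distinct same-residue nodes `x = (a, c)` and `y = (b, d)`, if the axial
distance `b - a + c - d` equals `n t` with `t ≥ 0` then `x ≻ y` iff `c - d > A t`, while
if `a - b + d - c = n t` with `t ≥ 0` then `x ≻ y` iff `d - c ≤ A t` (reading `A 0 = 0`). -/
def NodeGt (n : ℕ) (A : ℕ → ℤ) (x y : ℕ × ℕ) : Prop :=
  (∃ t : ℕ, (y.1 : ℤ) - x.1 + x.2 - y.2 = (n : ℤ) * t ∧ Aext A t < (x.2 : ℤ) - y.2) ∨
  (∃ t : ℕ, (x.1 : ℤ) - y.1 + y.2 - x.2 = (n : ℤ) * t ∧ (y.2 : ℤ) - x.2 ≤ Aext A t ∧ x ≠ y)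

/-- The (finite) set of addable and removable `i`-nodes of `l`. -/
noncomputable def ARset (n : ℕ) (l : ℕ → ℕ) (i : ZMod n) : Finset (ℕ × ℕ) :=
  ((Finset.range (conj l 0 + 1)) ×ˢ (Finset.range (l 0 + 1))).filter
    (fun x => res n x = i ∧ (Addable l x.1 x.2 ∨ Removable l x.1 x.2))

/-- The sign of a node in the ±-sequence: `+1` if addable, `-1` if removable. -/
noncomputable def sgnNode (l : ℕ → ℕ) (x : ℕ × ℕ) : ℤ :=
  if Addable l x.1 x.2 then 1 else if Removable l x.1 x.2 then -1 else 0

/-- Minus the partial sum of signs over the addable/removable `i`-nodes `y ⪰ x`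
(the prefix of the ±-sequence ending at `x`, the nodes being listed in decreasing
`≻`-order). -/
noncomputable def Gnode (n : ℕ) (A : ℕ → ℤ) (l : ℕ → ℕ) (i : ZMod n) (x : ℕ × ℕ) : ℤ :=
  -(∑ y ∈ (ARset n l i).filter (fun y => y = x ∨ NodeGt n A y x), sgnNode l y)

/-- The sum of signs over the addable/removable `i`-nodes `y ⪯ x` (the suffix of the
±-sequence starting at `x`). -/
noncomputable def Hnode (n : ℕ) (A : ℕ → ℤ) (l : ℕ → ℕ) (i : ZMod n) (x : ℕ × ℕ) : ℤ :=
  ∑ y ∈ (ARset n l i).filter (fun y => y = x ∨ NodeGt n A x y), sgnNode l y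

/-- `ε_i(λ)`: the maximum of `0` and the partial sums `Gnode`. -/
noncomputable def epsP (n : ℕ) (A : ℕ → ℤ) (l : ℕ → ℕ) (i : ZMod n) : ℤ :=
  (ARset n l i).fold max 0 (Gnode n A l i)

/-- `φ_i(λ)`: the maximum of `0` and the partial sums `Hnode`. -/
noncomputable def phiP (n : ℕ) (A : ℕ → ℤ) (l : ℕ → ℕ) (i : ZMod n) : ℤ :=
  (ARset n l i).fold max 0 (Hnode n A l i)

/-- The `i`-good node of `l`: the node in the good position of the ±-sequence, i.e. the
`≻`-greatest addable/removable `i`-node achieving `Gnode = ε_i > 0` (or `none`). -/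
noncomputable def goodNode (n : ℕ) (A : ℕ → ℤ) (l : ℕ → ℕ) (i : ZMod n) : Option (ℕ × ℕ) :=
  if hx : ∃ x ∈ ARset n l i, 0 < epsP n A l i ∧ Gnode n A l i x = epsP n A l i ∧
      ∀ y ∈ ARset n l i, NodeGt n A y x → Gnode n A l i y ≠ epsP n A l i
  then some hx.choose else none

/-- The `i`-cogood node of `l`: the node in the cogood position of the ±-sequence, i.e.
the `≻`-least addable/removable `i`-node achieving `Hnode = φ_i > 0` (or `none`). -/
noncomputable def cogoodNode (n : ℕ) (A : ℕ → ℤ) (l : ℕ → ℕ) (i : ZMod n) :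
    Option (ℕ × ℕ) :=
  if hx : ∃ x ∈ ARset n l i, 0 < phiP n A l i ∧ Hnode n A l i x = phiP n A l i ∧
      ∀ y ∈ ARset n l i, NodeGt n A x y → Hnode n A l i y ≠ phiP n A l i
  then some hx.choose else none

/-- The crystal operator `ẽ_i`: remove the `i`-good node (shorten its row by one), or
`none` (the ghost element `0`) if there is none. -/
noncomputable def et (n : ℕ) (A : ℕ → ℤ) (l : ℕ → ℕ) (i : ZMod n) : Option (ℕ → ℕ) :=
  (goodNode n A l i).map fun x => Function.update l x.1 (l x.1 - 1)

/-- The crystal operator `f̃_i`: add the `i`-cogood node (lengthen its row by one), or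
`none` (the ghost element `0`) if there is none. -/
noncomputable def ft (n : ℕ) (A : ℕ → ℤ) (l : ℕ → ℕ) (i : ZMod n) : Option (ℕ → ℕ) :=
  (cogoodNode n A l i).map fun x => Function.update l x.1 (l x.1 + 1)

/-- `A` extended to all integers, so that `x ≻ y` iff `B m < c_x - c_y`, where `n m` is the
difference of the contents. -/
def BB (A : ℕ → ℤ) (m : ℤ) : ℤ :=
  if m = 0 then 0 else if 0 < m then A m.toNat else -A (-m).toNat - 1

lemma BB_pos (A : ℕ → ℤ) (t : ℕ) (ht : 1 ≤ t) : BB A (t : ℤ) = A t := by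
  unfold BB
  rw [if_neg (by omega), if_pos (by omega)]
  simp

lemma BB_neg (A : ℕ → ℤ) (t : ℕ) (ht : 1 ≤ t) : BB A (-(t : ℤ)) = -A t - 1 := by
  unfold BB
  rw [if_neg (by omega), if_neg (by omega)]
  simp

lemma BB_zero (A : ℕ → ℤ) : BB A 0 = 0 := by simp [BB]

lemma BB_cases (m : ℤ) : m = 0 ∨ (∃ t : ℕ, 1 ≤ t ∧ m = t) ∨ (∃ t : ℕ, 1 ≤ t ∧ m = -(t : ℤ)) := by
  rcases lt_trichotomy m 0 with h | h | h
  · exact Or.inr (Or.inr ⟨(-m).toNat, by omega, by omega⟩)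
  · exact Or.inl h
  · exact Or.inr (Or.inl ⟨m.toNat, by omega, by omega⟩)

lemma BB_symm (A : ℕ → ℤ) (m : ℤ) (hm : m ≠ 0) : BB A (-m) = -BB A m - 1 := by
  rcases BB_cases m with h | ⟨t, ht, rfl⟩ | ⟨t, ht, rfl⟩
  · exact absurd h hm
  · rw [BB_neg A t ht, BB_pos A t ht]
  · rw [neg_neg, BB_neg A t ht, BB_pos A t ht]; ring

lemma BB_add {n : ℕ} {A : ℕ → ℤ} (hA : IsArmSeq n A) (m k : ℤ) :
    BB A (m + k) ≤ BB A m + BB A k + 1 := by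
  have key := hA.2
  rcases BB_cases m with h | ⟨t, ht, rfl⟩ | ⟨t, ht, rfl⟩
  · subst h; rw [zero_add, BB_zero]; omega
  · rcases BB_cases k with h | ⟨u, hu, rfl⟩ | ⟨u, hu, rfl⟩
    · subst h; rw [add_zero, BB_zero]; omega
    · have := key t u ht hu
      rw [← Nat.cast_add, BB_pos A _ ht, BB_pos A _ hu, BB_pos A _ (by omega)]; omega
    · rw [BB_pos A _ ht, BB_neg A _ hu]
      rcases lt_trichotomy t u with h | h | h
      · obtain ⟨v, rfl⟩ := Nat.exists_eq_add_of_lt h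
        have := key t (v+1) ht (by omega)
        have e : (t : ℤ) + -((t + v + 1 : ℕ) : ℤ) = -((v + 1 : ℕ) : ℤ) := by push_cast; ring
        rw [e, BB_neg A _ (by omega)]
        rw [← add_assoc] at this
        omega
      · subst h; rw [add_neg_cancel, BB_zero]; omega
      · obtain ⟨v, rfl⟩ := Nat.exists_eq_add_of_lt h
        have := key u (v+1) hu (by omega)
        have e : ((u + v + 1 : ℕ) : ℤ) + -(u : ℤ) = ((v + 1 : ℕ) : ℤ) := by push_cast; ring
        rw [e, BB_pos A _ (by omega)]
        rw [← add_assoc] at this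
        omega
  · rcases BB_cases k with h | ⟨u, hu, rfl⟩ | ⟨u, hu, rfl⟩
    · subst h; rw [add_zero, BB_zero]; omega
    · rw [BB_neg A _ ht, BB_pos A _ hu]
      rcases lt_trichotomy t u with h | h | h
      · obtain ⟨v, rfl⟩ := Nat.exists_eq_add_of_lt h
        have := key t (v+1) ht (by omega)
        have e : -(t : ℤ) + ((t + v + 1 : ℕ) : ℤ) = ((v + 1 : ℕ) : ℤ) := by push_cast; ring
        rw [e, BB_pos A _ (by omega)]
        rw [← add_assoc] at this
        omega
      · subst h; rw [neg_add_cancel, BB_zero]; omega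
      · obtain ⟨v, rfl⟩ := Nat.exists_eq_add_of_lt h
        have := key u (v+1) hu (by omega)
        have e : -((u + v + 1 : ℕ) : ℤ) + (u : ℤ) = -((v + 1 : ℕ) : ℤ) := by push_cast; ring
        rw [e, BB_neg A _ (by omega)]
        rw [← add_assoc] at this
        omega
    · have := key t u ht hu
      have e : -(t : ℤ) + -(u : ℤ) = -((t + u : ℕ) : ℤ) := by push_cast; ring
      rw [e, BB_neg A _ ht, BB_neg A _ hu, BB_neg A _ (by omega)]; omega

/-- The content of a node. -/
def cont (x : ℕ × ℕ) : ℤ := (x.2 : ℤ) - x.1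

lemma nodeGt_iff (n : ℕ) (hn : 3 ≤ n) (A : ℕ → ℤ) (x y : ℕ × ℕ) :
    NodeGt n A x y ↔ ∃ m : ℤ, cont x - cont y = n * m ∧ BB A m < (x.2 : ℤ) - y.2 := by
  unfold NodeGt cont
  constructor
  · rintro (⟨t, h1, h2⟩ | ⟨t, h1, h2, h3⟩)
    · refine ⟨t, by linarith, ?_⟩
      rcases Nat.eq_zero_or_pos t with h | h
      · subst h; simpa [Aext, BB] using h2
      · rw [BB_pos A t h]; simpa [Aext, h.ne'] using h2
    · refine ⟨-t, by linarith, ?_⟩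
      rcases Nat.eq_zero_or_pos t with h | h
      · subst h
        simp only [Aext, if_true] at h2
        simp only [Nat.cast_zero, neg_zero, BB_zero]
        by_contra hc
        apply h3
        simp only [Nat.cast_zero, mul_zero] at h1
        ext <;> omega
      · rw [BB_neg A t h]; simp only [Aext, h.ne', if_false] at h2; linarith
  · rintro ⟨m, h1, h2⟩
    rcases BB_cases m with h | ⟨t, ht, rfl⟩ | ⟨t, ht, rfl⟩
    · subst h
      left
      refine ⟨0, by simp at h1 ⊢; linarith, ?_⟩
      simpa [Aext, BB] using h2
    · left
      rw [BB_pos A t ht] at h2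
      exact ⟨t, by linarith, by simpa [Aext, show t ≠ 0 by omega] using h2⟩
    · by_cases hxy : x = y
      · subst hxy
        exfalso
        have h4 : (0 : ℤ) < n * t := by
          have : 0 < n * t := Nat.mul_pos (by omega) (by omega)
          exact_mod_cast this
        linarith
      · right
        rw [BB_neg A t ht] at h2
        refine ⟨t, by linarith, ?_, hxy⟩
        simp only [Aext, show t ≠ 0 by omega, if_false]; linarith

lemma nodeGt_trans {n : ℕ} (hn : 3 ≤ n) {A : ℕ → ℤ} (hA : IsArmSeq n A) {x y z : ℕ × ℕ}
    (h1 : NodeGt n A x y) (h2 : NodeGt n A y z) : NodeGt n A x z := by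
  rw [nodeGt_iff n hn] at *
  obtain ⟨m, e1, l1⟩ := h1
  obtain ⟨k, e2, l2⟩ := h2
  have := BB_add hA m k
  exact ⟨m + k, by linarith, by linarith⟩

lemma nodeGt_irrefl {n : ℕ} (hn : 3 ≤ n) (A : ℕ → ℤ) (x : ℕ × ℕ) : ¬ NodeGt n A x x := by
  rw [nodeGt_iff n hn]
  rintro ⟨m, h1, h2⟩
  have : (n : ℤ) * m = 0 := by linarith
  rcases mul_eq_zero.mp this with h | h
  · omega
  · subst h; rw [BB_zero] at h2; linarith

lemma res_cont (n : ℕ) (x : ℕ × ℕ) : res n x = ((cont x : ℤ) : ZMod n) := by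
  simp [res, cont]

lemma res_eq_iff (n : ℕ) (x y : ℕ × ℕ) :
    res n x = res n y ↔ ∃ m : ℤ, cont x - cont y = n * m := by
  rw [res_cont, res_cont, eq_comm, ZMod.intCast_eq_intCast_iff_dvd_sub]
  rfl

lemma nodeGt_total {n : ℕ} (hn : 3 ≤ n) (A : ℕ → ℤ) {x y : ℕ × ℕ}
    (h : res n x = res n y) (hxy : x ≠ y) : NodeGt n A x y ∨ NodeGt n A y x := by
  rw [nodeGt_iff n hn, nodeGt_iff n hn]
  obtain ⟨m, hm⟩ := (res_eq_iff n x y).mp h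
  by_cases h0 : m = 0
  · subst h0
    rw [mul_zero] at hm
    have : x.2 ≠ y.2 := by
      intro h2; apply hxy; unfold cont at hm; ext <;> omega
    rcases lt_or_gt_of_ne this with h3 | h3
    · right; exact ⟨0, by linarith, by rw [BB_zero]; omega⟩
    · left; exact ⟨0, by linarith, by rw [BB_zero]; omega⟩
  · by_cases h1 : BB A m < (x.2 : ℤ) - y.2
    · left; exact ⟨m, hm, h1⟩
    · right; exact ⟨-m, by linarith, by rw [BB_symm A m h0]; linarith⟩

/-- `x` is barely greater than `y`. -/
def Barely (n : ℕ) (A : ℕ → ℤ) (x y : ℕ × ℕ) : Prop :=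
  ∃ m : ℤ, cont x - cont y = n * m ∧ (x.2 : ℤ) - y.2 = BB A m + 1

lemma Barely.gt {n : ℕ} (hn : 3 ≤ n) {A : ℕ → ℤ} {x y : ℕ × ℕ} (h : Barely n A x y) :
    NodeGt n A x y := by
  rw [nodeGt_iff n hn]
  obtain ⟨m, h1, h2⟩ := h
  exact ⟨m, h1, by linarith⟩

lemma Barely.between {n : ℕ} (hn : 3 ≤ n) {A : ℕ → ℤ} (hA : IsArmSeq n A) {x w z : ℕ × ℕ}
    (h : Barely n A x z) (h1 : NodeGt n A x w) (h2 : NodeGt n A w z) :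
    Barely n A x w ∧ Barely n A w z := by
  rw [nodeGt_iff n hn] at *
  obtain ⟨m, e1, l1⟩ := h1
  obtain ⟨k, e2, l2⟩ := h2
  obtain ⟨j, e3, l3⟩ := h
  have hj : j = m + k := by
    have hn0 : (n : ℤ) ≠ 0 := by omega
    apply mul_left_cancel₀ hn0
    linarith
  subst hj
  have := BB_add hA m k
  exact ⟨⟨m, e1, by omega⟩, ⟨k, e2, by omega⟩⟩

lemma conj_eq {l : ℕ → ℕ} {q j : ℕ} (h1 : l j ≤ q) (h2 : ∀ k < j, q < l k) : conj l q = j := by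
  unfold conj
  apply le_antisymm
  · exact Nat.sInf_le h1
  · by_contra hc
    push Not at hc
    have h3 : l (sInf {a | l a ≤ q}) ≤ q := Nat.sInf_mem (s := {a | l a ≤ q}) ⟨j, h1⟩
    have := h2 _ hc
    omega

lemma conj_spec {l : ℕ → ℕ} {q N : ℕ} (hN : l N ≤ q) :
    l (conj l q) ≤ q ∧ ∀ k < conj l q, q < l k := by
  refine ⟨Nat.sInf_mem (s := {a | l a ≤ q}) ⟨N, hN⟩, fun k hk => ?_⟩
  by_contra hc
  push Not at hc
  have : conj l q ≤ k := Nat.sInf_le hc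
  omega

lemma IsPartition.anti {l : ℕ → ℕ} (hl : IsPartition l) : Antitone l :=
  antitone_nat_of_succ_le hl.1

lemma conj_addable {l : ℕ → ℕ} (hl : IsPartition l) {a c : ℕ} (h : Addable l a c) :
    conj l c = a := by
  refine conj_eq h.1.le fun k hk => ?_
  rcases h.2 with h2 | h2
  · omega
  · exact lt_of_lt_of_le h2 (hl.anti (by omega))

lemma conj_removable {l : ℕ → ℕ} (hl : IsPartition l) {a c : ℕ} (h : Removable l a c) :
    conj l c = a + 1 := by
  refine conj_eq h.2 fun k hk => ?_
  have := hl.anti (show k ≤ a by omega)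
  have := h.1
  omega

lemma not_barely {n : ℕ} {A : ℕ → ℤ} (hA : IsArmSeq n A) {l : ℕ → ℕ}
    (hl : IsPartition l) (hreg : ARegular n A l) {w z : ℕ × ℕ}
    (hw : Addable l w.1 w.2) (hz : Removable l z.1 z.2) : ¬ Barely n A w z := by
  obtain ⟨b, d⟩ := w
  obtain ⟨e, f⟩ := z
  rintro ⟨m, h1, h2⟩
  simp only [cont] at h1 h2 hw hz
  have cw := conj_addable hl hw
  have cz := conj_removable hl hz
  have w1 := hw.1
  have z1 := hz.1
  rcases BB_cases m with h | ⟨t, ht, rfl⟩ | ⟨t, ht, rfl⟩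
  · subst h
    rw [BB_zero] at h2
    rw [mul_zero] at h1
    have : b = e + 1 := by omega
    subst this
    have := hz.2
    omega
  · rw [BB_pos A t ht] at h2
    have := (hA.1 t ht).1
    apply hreg
    refine ⟨b, f, t, ht, by omega, ?_, by omega⟩
    rw [cz, w1]; push_cast; linarith
  · rw [BB_neg A t ht] at h2
    have := (hA.1 t ht).1
    apply hreg
    refine ⟨e, d, t, ht, by omega, ?_, by omega⟩
    rw [cw, z1]; push_cast; linarith

lemma add_case {n : ℕ} (hn : 3 ≤ n) {A : ℕ → ℤ} {l : ℕ → ℕ}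
    (hl : IsPartition l) (hreg : ARegular n A l) {a c : ℕ} (hx : Addable l a c)
    (hill : ¬ ARegular n A (Function.update l a (l a + 1))) :
    ∃ y : ℕ × ℕ, Addable l y.1 y.2 ∧ Barely n A y (a, c) := by
  unfold ARegular at hill
  push Not at hill
  obtain ⟨p, q, t, ht, h1, h2, h3⟩ := hill
  set μ := Function.update l a (l a + 1) with hμ
  have μa : μ a = c + 1 := by rw [hμ, Function.update_self, hx.1]
  have μne : ∀ j, j ≠ a → μ j = l j := fun j hj => by rw [hμ, Function.update_of_ne hj]
  have cx := conj_addable hl hx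
  have la := hx.1
  have hnt : (1 : ℤ) < n * t := by
    have : 3 * 1 ≤ n * t := Nat.mul_le_mul hn ht
    have : (3 : ℤ) ≤ n * t := by exact_mod_cast this
    linarith
  obtain ⟨N, hN⟩ := hl.2
  have hspec : μ (conj μ q) ≤ q ∧ ∀ k < conj μ q, q < μ k := by
    have h4 : l (N + a + 1) ≤ l N := hl.anti (by omega)
    refine conj_spec (N := N + a + 1) ?_
    rw [μne _ (by omega)]; omega
  have hcc : conj μ c = a + 1 := by
    refine conj_eq ?_ fun k hk => ?_
    · rw [μne _ (by omega)]
      have := hl.1 a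
      omega
    · by_cases hka : k = a
      · subst hka; omega
      · rw [μne _ hka]
        rcases hx.2 with h | h
        · omega
        · exact lt_of_lt_of_le h (hl.anti (by omega))
  by_cases hp : p = a
  · subst hp
    by_cases hq : q = c
    · subst hq
      rw [hcc, μa] at h2
      push_cast at h2
      exfalso
      linarith
    · set g := conj μ q with hg
      have hga : g ≠ p := by
        intro h
        have := hspec.1
        rw [h] at this
        omega
      have lg : l g ≤ q := by rw [← μne g hga]; exact hspec.1
      have hlt : ∀ k < g, q < l k := by
        intro k hk
        have := hspec.2 k hk
        by_cases hkp : k = p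
        · subst hkp; omega
        · rwa [μne k hkp] at this
      rw [μa] at h1 h2 h3
      rcases lg.lt_or_eq with h4 | h4
      · exfalso
        apply hreg
        have : conj l (q - 1) = g := by
          refine conj_eq (by omega) fun k hk => ?_
          have := hlt k hk
          omega
        refine ⟨p, q - 1, t, ht, by omega, ?_, by omega⟩
        rw [this, la]
        push_cast [show 1 ≤ q by omega] at h2 ⊢
        linarith
      · refine ⟨(g, q), ⟨h4, ?_⟩, -t, ?_, ?_⟩
        · by_cases hg0 : g = 0
          · left; exact hg0
          · right; exact hlt _ (by change g - 1 < g; omega)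
        · simp only [cont]; push_cast at h2; linarith
        · rw [BB_neg A t ht]; push_cast at h3 ⊢; linarith
  · rw [μne p hp] at h1 h2 h3
    by_cases hq : q = c
    · subst hq
      rw [hcc] at h2
      by_cases hadd : p = 0 ∨ l p < l (p - 1)
      · refine ⟨(p, l p), ⟨rfl, hadd⟩, t, ?_, ?_⟩
        · simp only [cont]; push_cast at h2; linarith
        · rw [BB_pos A t ht]; dsimp only; linarith
      · exfalso
        push Not at hadd
        have h5 := hl.anti (show p - 1 ≤ p by omega)
        have h6 : l (p - 1) = l p := le_antisymm hadd.2 h5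
        apply hreg
        refine ⟨p - 1, q, t, ht, by omega, ?_, by omega⟩
        rw [cx, h6]
        push_cast [show 1 ≤ p by omega] at h2 ⊢
        linarith
    · exfalso
      apply hreg
      refine ⟨p, q, t, ht, h1, ?_, h3⟩
      rw [← h2]
      congr 2
      refine conj_eq ?_ fun k hk => ?_
      · have := hspec.1
        by_cases hg : conj μ q = a
        · rw [hg] at this ⊢; omega
        · rwa [μne _ hg] at this
      · have := hspec.2 k hk
        by_cases hg : k = a
        · rw [hg] at this ⊢; omega
        · rwa [μne _ hg] at this

lemma remove_case {n : ℕ} {A : ℕ → ℤ} (hA : IsArmSeq n A) {l : ℕ → ℕ}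
    (hl : IsPartition l) (hreg : ARegular n A l) {a c : ℕ} (hx : Removable l a c)
    (hill : ¬ ARegular n A (Function.update l a (l a - 1))) :
    ∃ y : ℕ × ℕ, Removable l y.1 y.2 ∧ Barely n A (a, c) y := by
  unfold ARegular at hill
  push Not at hill
  obtain ⟨p, q, t, ht, h1, h2, h3⟩ := hill
  set μ := Function.update l a (l a - 1) with hμ
  have μa : μ a = c := by rw [hμ, Function.update_self, hx.1]; omega
  have μne : ∀ j, j ≠ a → μ j = l j := fun j hj => by rw [hμ, Function.update_of_ne hj]
  have cx := conj_removable hl hx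
  have la := hx.1
  have hAt := (hA.1 t ht).2
  obtain ⟨N, hN⟩ := hl.2
  have hspec : μ (conj μ q) ≤ q ∧ ∀ k < conj μ q, q < μ k := by
    have h4 : l (N + a + 1) ≤ l N := hl.anti (by omega)
    refine conj_spec (N := N + a + 1) ?_
    rw [μne _ (by omega)]; omega
  have hcc : conj μ c = a := by
    refine conj_eq μa.le fun k hk => ?_
    rw [μne _ (by omega)]
    have := hl.anti hk.le
    omega
  by_cases hp : p = a
  · subst hp
    set g := conj μ q with hg
    rw [μa] at h1 h2 h3
    have hga : g ≠ p := by
      intro h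
      have := hspec.1
      rw [h] at this
      omega
    have lg : l g ≤ q := by rw [← μne g hga]; exact hspec.1
    have hlt : ∀ k < g, q < l k := by
      intro k hk
      have := hspec.2 k hk
      by_cases hkp : k = p
      · subst hkp; omega
      · rwa [μne k hkp] at this
    have hg1 : 1 ≤ g := by
      by_contra h0
      have h0 : g = 0 := by omega
      rw [h0] at h2
      push_cast at h2
      have : (1 : ℤ) ≤ t := by exact_mod_cast ht
      have : (0 : ℤ) ≤ p := by positivity
      nlinarith
    have hl1 := hlt (g - 1) (by omega)
    by_cases h4 : l (g - 1) = q + 1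
    · refine ⟨(g - 1, q), ⟨h4, ?_⟩, t, ?_, ?_⟩
      · change l (g - 1 + 1) ≤ q
        rw [Nat.sub_add_cancel hg1]; exact lg
      · simp only [cont]; push_cast [hg1]; linarith
      · rw [BB_pos A t ht]; dsimp only; linarith
    · exfalso
      apply hreg
      have : conj l (q + 1) = g := by
        refine conj_eq (by omega) fun k hk => ?_
        have := hl.anti (show k ≤ g - 1 by omega)
        omega
      refine ⟨p, q + 1, t, ht, by omega, ?_, by rw [la]; push_cast; linarith⟩
      rw [this, la]
      push_cast
      linarith
  · rw [μne p hp] at h1 h2 h3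
    by_cases hq : q = c
    · subst hq
      rw [hcc] at h2
      by_cases hrem : l (p + 1) ≤ l p - 1
      · refine ⟨(p, l p - 1), ⟨by change l p = l p - 1 + 1; omega, hrem⟩, -t, ?_, ?_⟩
        · simp only [cont]; push_cast [show 1 ≤ l p by omega]; linarith
        · rw [BB_neg A t ht]; push_cast [show 1 ≤ l p by omega]; linarith
      · exfalso
        have h6 : l (p + 1) = l p := le_antisymm (hl.1 p) (by omega)
        apply hreg
        refine ⟨p + 1, q, t, ht, by omega, ?_, by omega⟩
        rw [cx, h6]
        push_cast
        linarith
    · exfalso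
      apply hreg
      refine ⟨p, q, t, ht, h1, ?_, h3⟩
      rw [← h2]
      congr 2
      refine conj_eq ?_ fun k hk => ?_
      · have := hspec.1
        by_cases hg : conj μ q = a
        · rw [hg] at this ⊢; omega
        · rwa [μne _ hg] at this
      · have := hspec.2 k hk
        by_cases hg : k = a
        · rw [hg] at this ⊢; omega
        · rwa [μne _ hg] at this

lemma exists_top {α : Type*} (S : Finset α) (r : α → α → Prop)
    (tr : ∀ x y z, r x y → r y z → r x z)
    (tot : ∀ x ∈ S, ∀ y ∈ S, x ≠ y → r x y ∨ r y x) (hS : S.Nonempty) :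
    ∃ x ∈ S, ∀ y ∈ S, y = x ∨ r x y := by
  induction hS using Finset.Nonempty.cons_induction with
  | singleton a => exact ⟨a, by simp, by simp⟩
  | cons a T ha hT ih =>
    obtain ⟨x, hx, hxT⟩ := ih fun u hu v hv => tot u (by simp [hu]) v (by simp [hv])
    have hax : a ≠ x := by rintro rfl; exact ha hx
    rcases tot a (by simp) x (by simp [hx]) hax with h | h
    · refine ⟨a, by simp, fun y hy => ?_⟩
      rcases Finset.mem_cons.mp hy with rfl | hy
      · left; rfl
      · right
        rcases hxT y hy with rfl | h2
        · exact h
        · exact tr _ _ _ h h2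
    · refine ⟨x, by simp [hx], fun y hy => ?_⟩
      rcases Finset.mem_cons.mp hy with rfl | hy
      · right; exact h
      · exact hxT y hy

lemma seq_lemma {α : Type*} (S : Finset α) (r : α → α → Prop) (s : α → ℤ)
    (tr : ∀ x y z, r x y → r y z → r x z) (irr : ∀ x, ¬ r x x)
    (tot : ∀ x ∈ S, ∀ y ∈ S, x ≠ y → r x y ∨ r y x)
    (x : α) (hx : x ∈ S) (F : α → ℤ)
    (hF : ∀ z, F z = ∑ y ∈ S.filter (fun y => y = z ∨ r z y), s y)
    (hpos : 0 < F x) (hmax : ∀ z ∈ S, F z ≤ F x) :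
    0 ≤ s x ∧ ∀ y ∈ S, r y x → 0 < s y → ∃ z ∈ S, r y z ∧ r z x ∧ s z < 0 := by
  simp only [hF] at hpos hmax
  constructor
  · have e1 : S.filter (fun y => y = x ∨ r x y) = insert x (S.filter (fun y => r x y)) := by
      ext y
      simp only [Finset.mem_filter, Finset.mem_insert]
      constructor
      · rintro ⟨h1, h2 | h2⟩
        · left; exact h2
        · right; exact ⟨h1, h2⟩
      · rintro (h | ⟨h1, h2⟩)
        · exact ⟨h ▸ hx, Or.inl h⟩
        · exact ⟨h1, Or.inr h2⟩
    have e2 : ∑ y ∈ S.filter (fun y => y = x ∨ r x y), s y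
        = s x + ∑ y ∈ S.filter (fun y => r x y), s y := by
      rw [e1, Finset.sum_insert]
      simp [irr x]
    rcases (S.filter (fun y => r x y)).eq_empty_or_nonempty with h | h
    · rw [e2, h] at hpos
      simp at hpos
      exact hpos.le
    · obtain ⟨w, hw, hwT⟩ := exists_top _ r tr
        (fun u hu v hv => tot u (Finset.mem_filter.mp hu).1 v (Finset.mem_filter.mp hv).1) h
      obtain ⟨hwS, hxw⟩ := Finset.mem_filter.mp hw
      have e3 : S.filter (fun y => y = w ∨ r w y) = S.filter (fun y => r x y) := by
        ext y
        simp only [Finset.mem_filter]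
        constructor
        · rintro ⟨h1, h2 | h2⟩
          · exact ⟨h1, h2 ▸ hxw⟩
          · exact ⟨h1, tr _ _ _ hxw h2⟩
        · rintro ⟨h1, h2⟩
          exact ⟨h1, hwT y (Finset.mem_filter.mpr ⟨h1, h2⟩)⟩
      have := hmax w hwS
      rw [e3, e2] at this
      linarith
  · intro y hy hyx hsy
    by_contra hc
    push Not at hc
    have hsub : S.filter (fun z => z = x ∨ r x z) ⊆ S.filter (fun z => z = y ∨ r y z) := by
      intro z hz
      obtain ⟨h1, h2⟩ := Finset.mem_filter.mp hz
      refine Finset.mem_filter.mpr ⟨h1, Or.inr ?_⟩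
      rcases h2 with rfl | h2
      · exact hyx
      · exact tr _ _ _ hyx h2
    have h1 := Finset.sum_sdiff hsub (f := s)
    have h2 : 0 < ∑ z ∈ S.filter (fun z => z = y ∨ r y z) \ S.filter (fun z => z = x ∨ r x z), s z := by
      refine Finset.sum_pos' ?_ ⟨y, ?_, hsy⟩
      · intro z hz
        obtain ⟨hz1, hz2⟩ := Finset.mem_sdiff.mp hz
        obtain ⟨hzS, hz1⟩ := Finset.mem_filter.mp hz1
        rcases hz1 with rfl | hz1
        · exact hsy.le
        · have hz3 : ¬ (z = x ∨ r x z) := fun h => hz2 (Finset.mem_filter.mpr ⟨hzS, h⟩)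
          push Not at hz3
          have := (tot z hzS x hx hz3.1).resolve_right hz3.2
          exact hc z hzS hz1 this
      · refine Finset.mem_sdiff.mpr ⟨Finset.mem_filter.mpr ⟨hy, Or.inl rfl⟩, fun h => ?_⟩
        rcases (Finset.mem_filter.mp h).2 with rfl | h
        · exact irr _ hyx
        · exact irr _ (tr _ _ _ h hyx)
    have := hmax y hy
    linarith

lemma le_fold_max' {α : Type*} (S : Finset α) (f : α → ℤ) (x : α) (hx : x ∈ S) :
    f x ≤ S.fold max 0 f :=
  Finset.le_fold_max _ |>.mpr (Or.inr ⟨x, hx, le_rfl⟩)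

lemma mem_ARset {n : ℕ} {l : ℕ → ℕ} (hl : IsPartition l) {i : ZMod n} {x : ℕ × ℕ} :
    x ∈ ARset n l i ↔ res n x = i ∧ (Addable l x.1 x.2 ∨ Removable l x.1 x.2) := by
  unfold ARset
  rw [Finset.mem_filter]
  refine ⟨fun h => h.2, fun h => ⟨?_, h⟩⟩
  obtain ⟨N, hN⟩ := hl.2
  have hs := (conj_spec (l := l) (q := 0) (N := N) hN.le).1
  have h0 := hl.anti (Nat.zero_le x.1)
  rw [Finset.mem_product, Finset.mem_range, Finset.mem_range]
  rcases h.2 with h | h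
  · refine ⟨?_, by have := h.1; omega⟩
    rcases h.2 with h2 | h2
    · omega
    · by_contra hc
      have := hl.anti (show conj l 0 ≤ x.1 - 1 by omega)
      omega
  · refine ⟨?_, by have := h.1; omega⟩
    by_contra hc
    have := hl.anti (show conj l 0 ≤ x.1 by omega)
    have := h.1
    omega

lemma sgn_addable {l : ℕ → ℕ} {x : ℕ × ℕ} (h : Addable l x.1 x.2) : sgnNode l x = 1 := by
  simp [sgnNode, h]

lemma sgn_removable {l : ℕ → ℕ} {x : ℕ × ℕ} (h : Removable l x.1 x.2) : sgnNode l x = -1 := by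
  have : ¬ Addable l x.1 x.2 := fun h2 => by
    have := h.1
    have := h2.1
    omega
  simp [sgnNode, h, this]


/-- Proposition 5.1 of the paper: the crystal operators preserve `A`-regularity:
if `f̃_i λ ≠ 0` then `f̃_i λ` is `A`-regular, and if `ẽ_i λ ≠ 0` then `ẽ_i λ` is
`A`-regular. -/
theorem crystal_operators_preserve_regularity (n : ℕ) (hn : 3 ≤ n)
    (A : ℕ → ℤ) (hA : IsArmSeq n A) (l : ℕ → ℕ) (hl : IsPartition l)
    (hreg : ARegular n A l) (i : ZMod n) :
    (∀ l' : ℕ → ℕ, ft n A l i = some l' → ARegular n A l') ∧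
    (∀ l' : ℕ → ℕ, et n A l i = some l' → ARegular n A l') := by
  have tot : ∀ x ∈ ARset n l i, ∀ y ∈ ARset n l i, x ≠ y → NodeGt n A x y ∨ NodeGt n A y x := by
    intro x hx y hy hxy
    exact nodeGt_total hn A
      (((mem_ARset hl).mp hx).1.trans ((mem_ARset hl).mp hy).1.symm) hxy
  constructor
  · intro l' hft
    unfold ft cogoodNode at hft
    split_ifs at hft with hex
    · simp only [Option.map_some, Option.some.injEq] at hft
      obtain ⟨hxS, hpos, hH, -⟩ := hex.choose_spec
      set x := hex.choose
      subst hft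
      by_contra hill
      obtain ⟨hsx, hall⟩ := seq_lemma (ARset n l i) (NodeGt n A) (sgnNode l)
        (fun _ _ _ => nodeGt_trans hn hA) (nodeGt_irrefl hn A) tot x hxS
        (Hnode n A l i) (fun z => by unfold Hnode; congr!)
        (by rw [hH]; exact hpos)
        (fun z hz => by rw [hH]; exact le_fold_max' _ _ z hz)
      obtain ⟨hres, hAR⟩ := (mem_ARset hl).mp hxS
      have hadd : Addable l x.1 x.2 := by
        rcases hAR with h | h
        · exact h
        · rw [sgn_removable h] at hsx; omega
      obtain ⟨y, hy, hyx⟩ := add_case hn hl hreg hadd hill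
      have hyS : y ∈ ARset n l i := by
        refine (mem_ARset hl).mpr ⟨?_, Or.inl hy⟩
        rw [← hres]
        obtain ⟨m, hm, -⟩ := hyx
        exact (res_eq_iff n y x).mpr ⟨m, hm⟩
      obtain ⟨z, hzS, hyz, hzx, hsz⟩ := hall y hyS (hyx.gt hn) (by rw [sgn_addable hy]; omega)
      have hz : Removable l z.1 z.2 := by
        rcases ((mem_ARset hl).mp hzS).2 with h | h
        · rw [sgn_addable h] at hsz; omega
        · exact h
      exact not_barely hA hl hreg hy hz (hyx.between hn hA hyz hzx).1
    · simp at hft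
  · intro l' het
    unfold et goodNode at het
    split_ifs at het with hex
    · simp only [Option.map_some, Option.some.injEq] at het
      obtain ⟨hxS, hpos, hG, -⟩ := hex.choose_spec
      set x := hex.choose
      subst het
      by_contra hill
      have hGn : ∀ z, Gnode n A l i z =
          ∑ y ∈ (ARset n l i).filter (fun y => y = z ∨ NodeGt n A y z), -sgnNode l y := by
        intro z
        rw [Finset.sum_neg_distrib]; rfl
      obtain ⟨hsx, hall⟩ := seq_lemma (ARset n l i) (fun u v => NodeGt n A v u)
        (fun y => -sgnNode l y)
        (fun _ _ _ h1 h2 => nodeGt_trans hn hA h2 h1) (nodeGt_irrefl hn A)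
        (fun u hu v hv h => (tot u hu v hv h).symm) x hxS
        (Gnode n A l i) (fun z => by rw [hGn]; congr!)
        (by rw [hG]; exact hpos)
        (fun z hz => by rw [hG]; exact le_fold_max' _ _ z hz)
      obtain ⟨hres, hAR⟩ := (mem_ARset hl).mp hxS
      have hrem : Removable l x.1 x.2 := by
        rcases hAR with h | h
        · rw [sgn_addable h] at hsx; omega
        · exact h
      obtain ⟨y, hy, hxy⟩ := remove_case hA hl hreg hrem hill
      have hyS : y ∈ ARset n l i := by
        refine (mem_ARset hl).mpr ⟨?_, Or.inr hy⟩
        rw [← hres]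
        obtain ⟨m, hm, -⟩ := hxy
        exact ((res_eq_iff n x y).mpr ⟨m, hm⟩).symm
      obtain ⟨z, hzS, hzy, hxz, hsz⟩ := hall y hyS (hxy.gt hn) (by rw [sgn_removable hy]; omega)
      have hz : Addable l z.1 z.2 := by
        rcases ((mem_ARset hl).mp hzS).2 with h | h
        · exact h
        · rw [sgn_removable h] at hsz; omega
      exact not_barely hA hl hreg hz hy (hxy.between hn hA hxz hzy).2
    · simp at het

end ArmCrystal
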